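/- For every integer n ≥ 0, Σ_{j=0}^{∞} (−1)^{T_j} Q(n − 2G_j) equals 1 if n is a triangular number (n = T_m for some integer m ≥ 0) and equals 0 otherwise; the sum is finite since Q vanishes on negative arguments. -/

import Mathlib

/-- The `n`-th triangular number `T n = n(n+1)/2`. -/
def T (n : ℕ) : ℕ := n * (n + 1) / 2

/-- The `n`-th generalized pentagonal number `G n = T n - T ⌊n/2⌋`. -/
def G (n : ℕ) : ℕ := T n - T (n / 2)

/-- The number of partitions of `n` into distinct parts, vanishing on negative integers. -/
def Q (n : ℤ) : ℤ :=
  if 0 ≤ n then ((Nat.Partition.distincts n.toNat).card : ℤ) else 0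

open Classical in
/-- `χ(n) = 1` if `n` is a triangular number, `0` otherwise. -/
noncomputable def chi (n : ℕ) : ℤ := if ∃ m, n = T m then 1 else 0

theorem two_mul_T (n : ℕ) : 2 * T n = n * (n + 1) :=
  Nat.mul_div_cancel' (Nat.even_mul_succ_self n).two_dvd

theorem T_strictMono : StrictMono T :=
  strictMono_nat_of_lt_succ fun n ↦ by nlinarith [two_mul_T n, two_mul_T (n + 1)]

theorem G_two_mul (m : ℕ) : G (2 * m) = pentagonal (-m) := by
  have h₁ := two_mul_T m
  have h₂ := two_mul_T (2 * m)
  have h₃ := two_mul_natCast_pentagonal_neg m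
  have h₄ : 2 * m / 2 = m := by lia
  rw [G, h₄]
  zify at h₁ h₂
  have : (T (2 * m) : ℤ) = T m + pentagonal (-m) := by linarith
  lia

theorem G_two_mul_add_one (m : ℕ) : G (2 * m + 1) = pentagonal (m + 1) := by
  have h₁ := two_mul_T m
  have h₂ := two_mul_T (2 * m + 1)
  have h₃ := two_mul_natCast_pentagonal (m + 1)
  have h₄ : (2 * m + 1) / 2 = m := by lia
  rw [G, h₄]
  zify at h₁ h₂
  have : (T (2 * m + 1) : ℤ) = T m + pentagonal (m + 1) := by linarith
  lia

section Shanks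

variable {R : Type*} [CommRing R]

/-- The product `∏_{k ≤ n} (1 - x ^ (2 k - 1))`. -/
def oddProd (x : R) (n : ℕ) : R := ∏ i ∈ Finset.range n, (1 - x ^ (2 * i + 1))

/-- The product `∏_{s < k ≤ n} (1 - x ^ (2 k))`. -/
def evenProd (x : R) (s n : ℕ) : R := ∏ i ∈ Finset.Ico s n, (1 - x ^ (2 * (i + 1)))

theorem oddProd_succ (x : R) (n : ℕ) :
    oddProd x (n + 1) = oddProd x n * (1 - x ^ (2 * n + 1)) :=
  Finset.prod_range_succ _ _

theorem evenProd_self (x : R) (n : ℕ) : evenProd x n n = 1 := by simp [evenProd]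

theorem evenProd_succ_right (x : R) {s n : ℕ} (h : s ≤ n) :
    evenProd x s (n + 1) = evenProd x s n * (1 - x ^ (2 * (n + 1))) :=
  Finset.prod_Ico_succ_top h _

theorem evenProd_eq_mul_succ_left (x : R) {s n : ℕ} (h : s < n) :
    evenProd x s n = (1 - x ^ (2 * (s + 1))) * evenProd x (s + 1) n :=
  Finset.prod_eq_prod_Ico_succ_bot h _

theorem sum_shanks_step (x : R) (n m : ℕ) (hm : m ≤ n) :
    ∑ s ∈ Finset.range m, (oddProd x s * evenProd x s (n + 1) * x ^ (s * (2 * n + 3)) -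
      (1 - x ^ (2 * n + 1)) * (oddProd x s * evenProd x s n * x ^ (s * (2 * n + 1)))) =
    oddProd x m * (1 - x ^ (2 * m)) * evenProd x m n * x ^ (m * (2 * n + 1)) := by
  induction m with
  | zero => simp
  | succ m ih =>
    rw [Finset.sum_range_succ, ih (by lia), evenProd_succ_right x (by lia : m ≤ n),
      evenProd_eq_mul_succ_left x (by lia : m < n), oddProd_succ]
    ring

/-- Shanks' finite form of Gauss' identity for triangular numbers, cleared of denominators. -/
theorem oddProd_mul_sum_pow_T (x : R) (n : ℕ) :
    oddProd x n * ∑ s ∈ Finset.range (2 * n), x ^ T s =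
      ∑ s ∈ Finset.range n, oddProd x s * evenProd x s n * x ^ (s * (2 * n + 1)) := by
  induction n with
  | zero => simp
  | succ n ih =>
    have h := sum_shanks_step x n n le_rfl
    rw [Finset.sum_sub_distrib, ← Finset.mul_sum, ← ih, evenProd_self] at h
    have h₀ : T (2 * n) = n * (2 * n + 1) := by linarith [two_mul_T (2 * n)]
    have h₁ : T (2 * n + 1) = n * (2 * n + 1) + (2 * n + 1) := by linarith [two_mul_T (2 * n + 1)]
    rw [show 2 * (n + 1) = 2 * n + 1 + 1 by ring, Finset.sum_range_succ, Finset.sum_range_succ,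
      Finset.sum_range_succ, evenProd_succ_right x le_rfl, evenProd_self, oddProd_succ, h₀, h₁,
      show 2 * n + 1 + 1 + 1 = 2 * n + 3 by ring]
    linear_combination -h

theorem oddProd_mul_evenProd (x : R) (n : ℕ) :
    oddProd x n * evenProd x 0 n = ∏ i ∈ Finset.range (2 * n), (1 - x ^ (i + 1)) := by
  induction n with
  | zero => simp [oddProd, evenProd]
  | succ n ih =>
    rw [oddProd_succ, evenProd_succ_right x n.zero_le, show 2 * (n + 1) = 2 * n + 1 + 1 by ring,
      Finset.prod_range_succ, Finset.prod_range_succ, ← ih]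
    ring

end Shanks

section Limits

open PowerSeries PowerSeries.WithPiTopology Filter Topology

theorem continuous_expand (p : ℕ) (hp : p ≠ 0) :
    Continuous (expand p hp : ℤ⟦X⟧ →ₐ[ℤ] ℤ⟦X⟧) := by
  rw [continuous_iff_continuousAt]
  intro f
  rw [ContinuousAt, tendsto_iff_coeff_tendsto]
  intro d
  simp_rw [coeff_expand]
  split_ifs
  · exact (continuous_coeff ℤ _).tendsto f
  · exact tendsto_const_nhds

theorem hasProd_one_sub_X_pow_two_mul :
    HasProd (fun n ↦ (1 - X ^ (2 * (n + 1)) : ℤ⟦X⟧)) (expand 2 two_ne_zero (pentagonalSeries ℤ)) := by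
  convert (hasProd_one_sub_X_pow ℤ).map (expand 2 two_ne_zero : ℤ⟦X⟧ →ₐ[ℤ] ℤ⟦X⟧)
    (continuous_expand 2 two_ne_zero) using 2 with n
  simp [pow_mul]

theorem tendsto_evenProd_X :
    Tendsto (evenProd (X : ℤ⟦X⟧) 0) atTop (𝓝 (expand 2 two_ne_zero (pentagonalSeries ℤ))) := by
  convert! hasProd_one_sub_X_pow_two_mul.tendsto_prod_nat using 2 with n
  rw [evenProd, Finset.range_eq_Ico]

theorem hasSum_pow_G :
    HasSum (fun j : ℕ ↦ ((-1) ^ T j * X ^ G j : ℤ⟦X⟧)) (pentagonalSeries ℤ) := by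
  rw [← Equiv.intEquivNat.hasSum_iff, ← (Equiv.neg ℤ).hasSum_iff]
  convert! hasSum_pentagonalSeries ℤ using 1
  ext1 k
  obtain ⟨m, rfl | rfl⟩ : ∃ m : ℕ, k = -m ∨ k = m + 1 := by
    rcases le_or_gt k 0 with h | h
    · exact ⟨k.natAbs, .inl (by lia)⟩
    · exact ⟨k.natAbs - 1, .inr (by lia)⟩
  · have : T (2 * m) = m + 2 * (m * m) := by linarith [two_mul_T (2 * m)]
    have e : Equiv.intEquivNat (m : ℤ) = 2 * m := rfl
    simp [e, G_two_mul, this, pow_add]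
  · have : T (2 * m + 1) = m + 1 + 2 * (m * m + m) := by linarith [two_mul_T (2 * m + 1)]
    have e : Equiv.intEquivNat (-((m : ℤ) + 1)) = 2 * m + 1 := by
      rw [← Int.negSucc_eq]; rfl
    simp [e, G_two_mul_add_one, this, pow_add, Int.negOnePow_add, -neg_add_rev]

theorem hasSum_pow_T : HasSum (fun s ↦ (X ^ T s : ℤ⟦X⟧)) (PowerSeries.mk chi) := by
  have h : (fun s ↦ (X ^ T s : ℤ⟦X⟧)) =
      (fun n ↦ monomial n ((PowerSeries.mk chi).coeff n)) ∘ T := by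
    ext1 s
    simp [chi, X_pow_eq]
  rw [h, T_strictMono.injective.hasSum_iff fun n hn ↦ ?_]
  · exact hasSum_of_monomials_self _
  · have : ¬ ∃ m, n = T m := fun ⟨m, hm⟩ ↦ hn ⟨m, hm.symm⟩
    simp [chi, this]

theorem exists_tendsto_oddProd_X :
    ∃ f : ℤ⟦X⟧, Tendsto (oddProd (X : ℤ⟦X⟧)) atTop (𝓝 f) := by
  have h : Multipliable fun i : ℕ ↦ (1 + -X ^ (2 * i + 1) : ℤ⟦X⟧) := by
    apply multipliable_one_add_of_tendsto_order_atTop_nhds_top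
    simp_rw [order_neg, order_X_pow]
    exact ENat.tendsto_natCast_nhds_top.comp
      (tendsto_atTop_mono (fun i ↦ (by lia : i ≤ 2 * i + 1)) tendsto_id)
  exact ⟨_, by simpa [oddProd, sub_eq_add_neg] using! h.hasProd.tendsto_prod_nat⟩

theorem tendsto_shanks_sum :
    Tendsto (fun n ↦ ∑ s ∈ Finset.range n,
      oddProd (X : ℤ⟦X⟧) s * evenProd X s n * X ^ (s * (2 * n + 1))) atTop
      (𝓝 (expand 2 two_ne_zero (pentagonalSeries ℤ))) := by
  have h := (tendsto_iff_coeff_tendsto _ _ _ _).mp tendsto_evenProd_X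
  rw [tendsto_iff_coeff_tendsto]
  intro d
  refine (h d).congr' ?_
  filter_upwards [eventually_ge_atTop (d + 1)] with n hn
  obtain ⟨k, rfl⟩ : ∃ k, n = k + 1 := ⟨n - 1, by lia⟩
  rw [Finset.sum_range_succ', map_add, map_sum, Finset.sum_eq_zero]
  · simp [oddProd]
  · intro s _
    rw [coeff_mul_X_pow', if_neg]
    nlinarith

/-- Gauss' identity for triangular numbers. -/
theorem mk_card_distincts_mul_expand_pentagonalSeries :
    PowerSeries.mk (fun n ↦ ((Nat.Partition.distincts n).card : ℤ)) *
      expand 2 two_ne_zero (pentagonalSeries ℤ) = PowerSeries.mk chi := by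
  obtain ⟨f, hf⟩ := exists_tendsto_oddProd_X
  have htwo : Tendsto (fun n : ℕ ↦ 2 * n) atTop atTop :=
    tendsto_atTop_mono (fun i ↦ (by lia : i ≤ 2 * i)) tendsto_id
  have hodd : f * expand 2 two_ne_zero (pentagonalSeries ℤ) = pentagonalSeries ℤ := by
    refine tendsto_nhds_unique (hf.mul tendsto_evenProd_X) ?_
    simp_rw [oddProd_mul_evenProd]
    exact (hasProd_one_sub_X_pow ℤ).tendsto_prod_nat.comp htwo
  have hgauss : f * PowerSeries.mk chi = expand 2 two_ne_zero (pentagonalSeries ℤ) := by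
    refine tendsto_nhds_unique (hf.mul (hasSum_pow_T.tendsto_sum_nat.comp htwo)) ?_
    simp only [Function.comp_apply, oddProd_mul_sum_pow_T]
    exact tendsto_shanks_sum
  have hdist : PowerSeries.mk (fun n ↦ ((Nat.Partition.distincts n).card : ℤ)) *
      pentagonalSeries ℤ = expand 2 two_ne_zero (pentagonalSeries ℤ) := by
    have h := Nat.Partition.hasProd_powerSeriesMk_card_countRestricted ℤ two_pos
    simp_rw [Nat.Partition.countRestricted_two] at h
    refine (h.mul (hasProd_one_sub_X_pow ℤ)).unique ?_
    convert! hasProd_one_sub_X_pow_two_mul using 1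
    ext1 n
    simp_rw [pow_mul, geom_sum_mul_neg, ← pow_mul, mul_comm]
  have hf₀ : f ≠ 0 := by
    rintro rfl
    have h := coeff_pentagonalSeries_pentagonal ℤ 0
    rw [← hodd, zero_mul] at h
    simp at h
  apply mul_left_cancel₀ hf₀
  rw [mul_left_comm, hodd, hdist, hgauss]

end Limits

open PowerSeries PowerSeries.WithPiTopology in
theorem stmt_1 (n : ℕ) :
    ∑' j : ℕ, (-1 : ℤ) ^ (T j) * Q ((n : ℤ) - 2 * (G j : ℤ)) = chi n := by
  have hG := hasSum_pow_G.map (expand 2 two_ne_zero : ℤ⟦X⟧ →ₐ[ℤ] ℤ⟦X⟧)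
    (continuous_expand 2 two_ne_zero)
  have h := (hasSum_iff_hasSum_coeff _).mp
    (hG.mul_left (PowerSeries.mk fun n ↦ ((Nat.Partition.distincts n).card : ℤ))) n
  rw [mk_card_distincts_mul_expand_pentagonalSeries, coeff_mk] at h
  rw [← h.tsum_eq]
  congr 1
  ext1 j
  have hC : ((-1) ^ T j : ℤ⟦X⟧) = C ((-1) ^ T j) := by simp
  simp only [Function.comp_apply, map_mul, map_pow, map_neg, map_one, expand_X, ← pow_mul]
  rw [mul_left_comm, hC, coeff_C_mul, coeff_mul_X_pow', Q]
  congr 1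
  by_cases hj : 2 * G j ≤ n
  · rw [if_pos hj, if_pos (by lia), coeff_mk,
      show ((n : ℤ) - 2 * G j).toNat = n - 2 * G j by lia]
  · rw [if_neg hj, if_neg (by lia)]
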